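/- Let k be a field, A a finitely generated commutative k-algebra, and σ : A → A a k-algebra involution. Let L_A = {a − σ(a) : a ∈ A}, an A^σ-submodule of A, and let I_A be the ideal of A generated by L_A. Assume I_A is an invertible ideal (a finitely generated projective A-module of rank one). Then the A-linear multiplication map A ⊗_{A^σ} L_A → A, a ⊗ x ↦ a·x, is injective with image I_A; equivalently, the sequence 0 → A ⊗_{A^σ} L_A → A → A/I_A → 0 is exact. -/

import Mathlib

/-- The fixed subring `A^σ` of a ring involution `σ`. -/
def fixedSubring {A : Type*} [CommRing A] (σ : A →+* A) : Subring A where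
  carrier := {a | σ a = a}
  mul_mem' := fun {a b} ha hb => by
    simp only [Set.mem_setOf_eq] at *; rw [map_mul, ha, hb]
  one_mem' := by simp only [Set.mem_setOf_eq, map_one]
  add_mem' := fun {a b} ha hb => by
    simp only [Set.mem_setOf_eq] at *; rw [map_add, ha, hb]
  zero_mem' := by simp only [Set.mem_setOf_eq, map_zero]
  neg_mem' := fun {a} ha => by
    simp only [Set.mem_setOf_eq] at *; rw [map_neg, ha]

/-- `L_A = {a - σ a : a ∈ A}` as an `A^σ`-submodule of `A`. -/
def lsub {A : Type*} [CommRing A] (σ : A →+* A) : Submodule (fixedSubring σ) A where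
  carrier := Set.range fun a => a - σ a
  add_mem' := by
    rintro _ _ ⟨a, rfl⟩ ⟨b, rfl⟩
    exact ⟨a + b, by simp only []; rw [map_add]; ring⟩
  zero_mem' := ⟨0, by simp⟩
  smul_mem' := by
    rintro ⟨c, hc⟩ _ ⟨a, rfl⟩
    refine ⟨c * a, ?_⟩
    have hc' : σ c = c := hc
    show c * a - σ (c * a) = c • (a - σ a)
    rw [map_mul, hc']
    show c * a - c * σ a = c * (a - σ a)
    ring

/-- The ideal `I_A` of `A` generated by `L_A = {a - σ a : a ∈ A}`. -/
def iideal {A : Type*} [CommRing A] (σ : A →+* A) : Ideal A :=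
  Ideal.span (Set.range fun a => a - σ a)

/-- An ideal is invertible if it is a finitely generated projective module of rank one. -/
def IsInvertibleIdeal {A : Type*} [CommRing A] (I : Ideal A) : Prop :=
  Module.Finite A I ∧ Module.Projective A I ∧
    ∀ p : PrimeSpectrum A, Module.rankAtStalk (R := A) I p = 1

/-- The `A^σ`-linear multiplication map `A ⊗_{A^σ} L_A → A`, `a ⊗ x ↦ a * x`. -/
noncomputable def mulMap {A : Type*} [CommRing A] (σ : A →+* A) :
    TensorProduct (fixedSubring σ) A (lsub σ) →ₗ[fixedSubring σ] A :=
  TensorProduct.lift ((LinearMap.mul (fixedSubring σ) A).compl₂ (lsub σ).subtype)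

open scoped TensorProduct

lemma mulMap_tmul {A : Type*} [CommRing A] (σ : A →+* A) (a : A) (x : lsub σ) :
    mulMap σ (a ⊗ₜ[fixedSubring σ] x) = a * (x : A) := by
  simp [mulMap]

lemma mulMap_smul {A : Type*} [CommRing A] (σ : A →+* A) (a : A)
    (t : TensorProduct (fixedSubring σ) A (lsub σ)) :
    mulMap σ (a • t) = a * mulMap σ t := by
  induction t with
  | zero => simp
  | tmul b x => rw [TensorProduct.smul_tmul', mulMap_tmul, mulMap_tmul, smul_eq_mul, mul_assoc]
  | add x y hx hy => rw [smul_add, map_add, hx, hy, map_add, mul_add]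

lemma range_mulMap {A : Type*} [CommRing A] (σ : A →+* A) :
    LinearMap.range (mulMap σ) =
      Submodule.restrictScalars (fixedSubring σ) (iideal σ) := by
  ext z
  rw [Submodule.restrictScalars_mem, LinearMap.mem_range]
  constructor
  · rintro ⟨t, rfl⟩
    induction t with
    | zero => simp
    | tmul b x =>
      rw [mulMap_tmul]
      exact Ideal.mul_mem_left _ _ (Ideal.subset_span x.2)
    | add x y hx hy => rw [map_add]; exact add_mem hx hy
  · intro hz
    refine Submodule.span_induction (p := fun z _ => ∃ t, mulMap σ t = z) ?_ ?_ ?_ ?_ hz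
    · intro x hx
      exact ⟨1 ⊗ₜ[fixedSubring σ] (⟨x, hx⟩ : lsub σ), by rw [mulMap_tmul]; simp⟩
    · exact ⟨0, map_zero _⟩
    · rintro _ _ _ _ ⟨s, rfl⟩ ⟨t, rfl⟩
      exact ⟨s + t, map_add _ _ _⟩
    · rintro a _ _ ⟨t, rfl⟩
      exact ⟨a • t, mulMap_smul σ a t⟩

/-- The trace ideal of an invertible ideal is everything. -/
lemma trace_not_le {A : Type*} [CommRing A] (I : Ideal A) (h : IsInvertibleIdeal I)
    (n : Ideal A) [hn : n.IsPrime] (H : ∀ (f : I →ₗ[A] A) (y : I), f y ∈ n) : False := by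
  obtain ⟨hfin, hproj, hrank⟩ := h
  obtain ⟨s, hs⟩ := hproj.out
  have hle : (⊤ : Submodule A I) ≤ n • ⊤ := by
    intro x _
    have h1 := hs x
    rw [← h1, Finsupp.linearCombination_apply, Finsupp.sum]
    exact Submodule.sum_mem _ fun y _ =>
      Submodule.smul_mem_smul (H ((Finsupp.lapply y).comp s) x) trivial
  obtain ⟨r, hr1, hr2⟩ := Submodule.exists_sub_one_mem_and_smul_eq_zero_of_fg_of_le_smul n
    (⊤ : Submodule A I) hfin.fg_top hle
  have hrn : r ∉ n := fun hr => hn.ne_top ((Ideal.eq_top_iff_one _).2 (by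
    simpa using sub_mem hr hr1))
  have hsub : Subsingleton (LocalizedModule n.primeCompl I) := by
    rw [LocalizedModule.subsingleton_iff]
    exact fun m => ⟨r, hrn, hr2 m trivial⟩
  have := hrank ⟨n, hn⟩
  rw [Module.rankAtStalk] at this
  have h0 := Module.finrank_zero_of_subsingleton (R := Localization.AtPrime n)
    (M := LocalizedModule n.primeCompl I)
  simp only [h0] at this
  exact zero_ne_one this

lemma isIntegral_fixed {A : Type*} [CommRing A] (σ : A →+* A) (hσ : ∀ a, σ (σ a) = a) :
    Algebra.IsIntegral (fixedSubring σ) A := by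
  refine ⟨fun a => ?_⟩
  let t : fixedSubring σ := ⟨a + σ a, by
    show σ (a + σ a) = a + σ a
    rw [map_add, hσ, add_comm]⟩
  let d : fixedSubring σ := ⟨a * σ a, by
    show σ (a * σ a) = a * σ a
    rw [map_mul, hσ, mul_comm]⟩
  refine ⟨Polynomial.X ^ 2 - (Polynomial.C t * Polynomial.X - Polynomial.C d), ?_, ?_⟩
  · apply Polynomial.monic_X_pow_sub
    compute_degree
    norm_num
  · simp only [Polynomial.eval₂_sub, Polynomial.eval₂_mul, Polynomial.eval₂_X_pow,
      Polynomial.eval₂_X, Polynomial.eval₂_C]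
    show a ^ 2 - ((a + σ a) * a - a * σ a) = 0
    ring

lemma sigma_lsub {A : Type*} [CommRing A] (σ : A →+* A) (hσ : ∀ a, σ (σ a) = a)
    {x : A} (hx : x ∈ lsub σ) : σ x = -x := by
  obtain ⟨a, rfl⟩ := hx
  simp only [map_sub, hσ]
  ring

lemma lsub_le {A : Type*} [CommRing A] (σ : A →+* A)
    {x : A} (hx : x ∈ lsub σ) : x ∈ iideal σ := Ideal.subset_span hx

/-- The norm of `a`. -/
def nrm {A : Type*} [CommRing A] (σ : A →+* A) (hσ : ∀ a, σ (σ a) = a) (a : A) :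
    fixedSubring σ := ⟨a * σ a, by
    show σ (a * σ a) = a * σ a
    rw [map_mul, hσ, mul_comm]⟩

/-- Key local step: `N = N(f y)` has `N^2 L ⊆ B y`. -/
lemma key_step {A : Type*} [CommRing A] (σ : A →+* A) (hσ : ∀ a, σ (σ a) = a)
    (f : iideal σ →ₗ[A] A) (y : A) (hy : y ∈ lsub σ) (N : fixedSubring σ)
    (hN : N = nrm σ hσ (f ⟨y, lsub_le σ hy⟩)) (x : lsub σ) :
    ∃ b : fixedSubring σ, N ^ 2 • x = b • (⟨y, hy⟩ : lsub σ) := by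
  set u := f ⟨y, lsub_le σ hy⟩ with hu
  set v := f ⟨x, lsub_le σ x.2⟩ with hv
  have hNv : (N : A) = u * σ u := by rw [hN]; rfl
  have hNs : σ (N : A) = N := N.2
  have huv : u * x = v * y := by
    have e : (x : A) • (⟨y, lsub_le σ hy⟩ : iideal σ) = y • ⟨x, lsub_le σ x.2⟩ :=
      Subtype.ext (mul_comm _ _)
    have := congrArg f e
    rw [map_smul, map_smul, smul_eq_mul, smul_eq_mul, ← hu, ← hv] at this
    linear_combination this
  have hsx := sigma_lsub σ hσ x.2
  have hsy := sigma_lsub σ hσ hy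
  have huv' : σ u * x = σ v * y := by
    have := congrArg σ huv
    rw [map_mul, map_mul, hsx, hsy] at this
    linear_combination -this
  have hz : (σ u * v - u * σ v) * y = 0 := by
    linear_combination u * huv' - σ u * huv
  have hz' : (σ u * v - u * σ v) * u = 0 := by
    have e : (σ u * v - u * σ v) • (⟨y, lsub_le σ hy⟩ : iideal σ) = 0 := Subtype.ext hz
    have := congrArg f e
    rwa [map_smul, map_zero, smul_eq_mul] at this
  refine ⟨⟨N * (σ u * v), ?_⟩, ?_⟩
  · show σ (N * (σ u * v)) = N * (σ u * v)
    rw [map_mul, map_mul, hNs, hσ, hNv]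
    linear_combination -σ u * hz'
  · apply Subtype.ext
    show (N : A) ^ 2 * x = N * (σ u * v) * y
    rw [hNv]
    linear_combination (u * σ u * σ u) * huv

lemma kill_step {A : Type*} [CommRing A] (σ : A →+* A) (hσ : ∀ a, σ (σ a) = a)
    (f : iideal σ →ₗ[A] A) (y : A) (hy : y ∈ lsub σ) (N : fixedSubring σ)
    (hN : N = nrm σ hσ (f ⟨y, lsub_le σ hy⟩))
    (t : TensorProduct (fixedSubring σ) A (lsub σ)) (ht : mulMap σ t = 0) :
    N ^ 3 • t = 0 := by
  have h1 : ∃ a : A, N ^ 2 • t = a ⊗ₜ[fixedSubring σ] (⟨y, hy⟩ : lsub σ) := by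
    clear ht
    induction t with
    | zero => exact ⟨0, by simp⟩
    | tmul a x =>
      obtain ⟨b, hb⟩ := key_step σ hσ f y hy N hN x
      exact ⟨b • a, by rw [← TensorProduct.tmul_smul, hb, TensorProduct.smul_tmul]⟩
    | add s t hs ht =>
      obtain ⟨a, ha⟩ := hs
      obtain ⟨b, hb⟩ := ht
      exact ⟨a + b, by rw [smul_add, ha, hb, TensorProduct.add_tmul]⟩
  obtain ⟨a, ha⟩ := h1
  have h2 : a * y = 0 := by
    have := congrArg (mulMap σ) ha
    rw [map_smul, ht, smul_zero, mulMap_tmul] at this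
    exact this.symm
  have h3 : a * f ⟨y, lsub_le σ hy⟩ = 0 := by
    have e : a • (⟨y, lsub_le σ hy⟩ : iideal σ) = 0 := Subtype.ext h2
    have := congrArg f e
    rwa [map_smul, map_zero, smul_eq_mul] at this
  have h4 : N • a = 0 := by
    have hNv : (N : A) = f ⟨y, lsub_le σ hy⟩ * σ (f ⟨y, lsub_le σ hy⟩) := by rw [hN]; rfl
    show (N : A) * a = 0
    rw [hNv]
    linear_combination σ (f ⟨y, lsub_le σ hy⟩) * h3
  rw [pow_succ', mul_smul, ha, TensorProduct.smul_tmul', h4, TensorProduct.zero_tmul]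

lemma mulMap_injective {A : Type*} [CommRing A] (σ : A →+* A) (hσ : ∀ a, σ (σ a) = a)
    (hpure : IsInvertibleIdeal (iideal σ)) : Function.Injective (mulMap σ) := by
  rw [injective_iff_map_eq_zero]
  intro t ht
  by_contra ht0
  let J : Ideal (fixedSubring σ) := LinearMap.ker (LinearMap.toSpanSingleton (fixedSubring σ) _ t)
  have hJ : J ≠ ⊤ := by
    intro h
    have : (1 : fixedSubring σ) ∈ J := h ▸ trivial
    exact ht0 (by simpa [J] using this)
  obtain ⟨m, hm, hJm⟩ := Ideal.exists_le_maximal J hJ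
  haveI := isIntegral_fixed σ hσ
  obtain ⟨n, hn, hnm⟩ := Ideal.exists_ideal_over_maximal_of_isIntegral (S := A) m (by
    rw [(RingHom.injective_iff_ker_eq_bot _).1 (Subtype.val_injective :
      Function.Injective (algebraMap (fixedSubring σ) A))]
    exact bot_le)
  haveI := hn.isPrime
  have hnorm : ∀ (f : iideal σ →ₗ[A] A) (y : A) (hy : y ∈ lsub σ),
      f ⟨y, lsub_le σ hy⟩ * σ (f ⟨y, lsub_le σ hy⟩) ∈ n := by
    intro f y hy
    have h3 : nrm σ hσ (f ⟨y, lsub_le σ hy⟩) ^ 3 ∈ m :=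
      hJm (kill_step σ hσ f y hy _ rfl t ht)
    have h1 := hm.isPrime.mem_of_pow_mem _ h3
    rw [← hnm] at h1
    exact h1
  have hinv : ∀ a ∈ n, σ a ∈ n := by
    intro a ha
    have hy : a - σ a ∈ lsub σ := ⟨a, rfl⟩
    have h := hnorm (iideal σ).subtype _ hy
    simp only [Submodule.subtype_apply, sigma_lsub σ hσ hy] at h
    rcases this.mem_or_mem h with h | h
    · simpa using sub_mem ha h
    · simpa using add_mem ha h
  have hL : ∀ (f : iideal σ →ₗ[A] A) (y : A) (hy : y ∈ lsub σ), f ⟨y, lsub_le σ hy⟩ ∈ n := by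
    intro f y hy
    rcases this.mem_or_mem (hnorm f y hy) with h | h
    · exact h
    · simpa [hσ] using hinv _ h
  refine trace_not_le (iideal σ) hpure n fun f y => ?_
  obtain ⟨y, hy⟩ := y
  refine Submodule.span_induction (p := fun z hz => f ⟨z, hz⟩ ∈ n) ?_ ?_ ?_ ?_ hy
  · intro x hx
    exact hL f x hx
  · have : f 0 ∈ n := by simp
    exact this
  · intro x y hx hy h1 h2
    have := add_mem h1 h2
    rwa [← map_add] at this
  · intro a x hx h
    have := n.mul_mem_left a h
    rwa [← smul_eq_mul, ← map_smul] at this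

/-- If `(A, σ)` is a pure involution of a finitely generated algebra over a field `k`
(`I_A` is an invertible ideal), then the multiplication map `A ⊗_{A^σ} L_A → A` is injective
with image `I_A`; i.e. `0 → A ⊗_{A^σ} L_A → A → A/I_A → 0` is exact. -/
theorem pure_involution_mul_map_injective_with_image
    {k : Type*} [Field k] {A : Type*} [CommRing A] [Algebra k A] [Algebra.FiniteType k A]
    (σ : A →ₐ[k] A) (hσ : ∀ a : A, σ (σ a) = a)
    (hpure : IsInvertibleIdeal (iideal σ.toRingHom)) :
    Function.Injective (mulMap σ.toRingHom) ∧
      LinearMap.range (mulMap σ.toRingHom) =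
        Submodule.restrictScalars (fixedSubring σ.toRingHom) (iideal σ.toRingHom) := by
  exact ⟨mulMap_injective σ.toRingHom hσ hpure, range_mulMap σ.toRingHom⟩
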